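/- Every non-smooth 2-dimensional real Banach space has the Mazur–Ulam property. That is, if X is a 2-dimensional real Banach space whose unit sphere contains a non-smooth point, then every surjective isometry f from the unit sphere S_X onto the unit sphere S_Y of an arbitrary real Banach space Y extends to a bijective linear isometry between X and Y. -/

import Mathlib

open Metric Set

/-- A point `x` of the unit sphere of `X` is *smooth* if there is a unique continuous
linear functional `g : X →L[ℝ] ℝ` with `g x = 1 = ‖g‖`. -/
def IsSmoothPoint {X : Type*} [NormedAddCommGroup X] [NormedSpace ℝ X] (x : X) : Prop :=
  ∃! g : X →L[ℝ] ℝ, g x = 1 ∧ ‖g‖ = 1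

open Filter Topology

section Tangents

variable {X : Type*} [NormedAddCommGroup X] [NormedSpace ℝ X]

theorem convexOn_norm_line (x b : X) : ConvexOn ℝ univ fun s : ℝ => ‖x + s • b‖ := by
  have := (convexOn_univ_norm (E := X)).comp_affineMap (AffineMap.lineMap x (x + b) : ℝ →ᵃ[ℝ] X)
  simpa [Function.comp_def, AffineMap.lineMap_apply, add_comm] using this

/-- The norm has one-sided directional derivatives. -/
theorem exists_hasDerivWithinAt_norm_line (x e : X) :
    ∃ c : ℝ, HasDerivWithinAt (fun s : ℝ => ‖x + s • e‖) c (Ioi 0) 0 :=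
  ⟨_, (convexOn_norm_line x e).hasDerivWithinAt_rightDeriv_of_mem_interior (by simp)⟩

/-- Compare right derivatives of functions that agree at the base point. -/
theorem le_of_hasDerivWithinAt_Ioi {F G : ℝ → ℝ} {F' G' : ℝ}
    (hF : HasDerivWithinAt F F' (Ioi 0) 0) (hG : HasDerivWithinAt G G' (Ioi 0) 0)
    (h0 : F 0 = G 0) (h : ∀ s > 0, F s ≤ G s) : F' ≤ G' := by
  rw [hasDerivWithinAt_iff_tendsto_slope' (by simp)] at hF hG
  refine le_of_tendsto_of_tendsto hF hG ?_
  filter_upwards [self_mem_nhdsWithin] with s hs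
  have hs' : (0 : ℝ) < s := hs
  simp only [slope_def_field, sub_zero, h0]
  have := h s hs'
  gcongr

theorem functional_le_of_hasDerivWithinAt_norm_line {x e : X} {c : ℝ}
    (hc : HasDerivWithinAt (fun s : ℝ => ‖x + s • e‖) c (Ioi 0) 0)
    (g : X →L[ℝ] ℝ) (hg : ‖g‖ ≤ 1) (hgx : g x = ‖x‖) : g e ≤ c := by
  have hG : HasDerivWithinAt (fun s : ℝ => g x + s * g e) (g e) (Ioi 0) 0 := by
    simpa using ((hasDerivWithinAt_id (0 : ℝ) (Ioi 0)).mul_const (g e)).const_add (g x)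
  refine le_of_hasDerivWithinAt_Ioi hG hc (by simp [hgx]) fun s _ => ?_
  calc g x + s * g e = g (x + s • e) := by simp
    _ ≤ ‖g (x + s • e)‖ := le_abs_self _
    _ ≤ 1 * ‖x + s • e‖ := g.le_of_opNorm_le hg _
    _ = _ := one_mul _

/-- The radial projection to the unit sphere of the line through `x` with direction `e`. -/
noncomputable def radialCurve (x e : X) (s : ℝ) : X := ‖x + s • e‖⁻¹ • (x + s • e)

theorem hasDerivWithinAt_radialCurve {x e : X} {c : ℝ} (hx : ‖x‖ = 1)
    (hc : HasDerivWithinAt (fun s : ℝ => ‖x + s • e‖) c (Ioi 0) 0) :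
    HasDerivWithinAt (radialCurve x e) (e - c • x) (Ioi 0) 0 := by
  have h1 : HasDerivWithinAt (fun s : ℝ => x + s • e) e (Ioi 0) 0 := by
    simpa using ((hasDerivWithinAt_id (0 : ℝ) (Ioi 0)).smul_const e).const_add x
  have := (hc.fun_inv (by simp [hx])).fun_smul h1
  simp only [zero_smul, add_zero, hx, inv_one, one_smul] at this
  have hd : e - c • x = e + (-c / 1 ^ 2) • x := by norm_num [sub_eq_add_neg]
  rw [hd]
  exact this

theorem hasDerivWithinAt_norm_line_tangent {x b : X} {y : ℝ → X} (hy : ∀ s, ‖y s‖ = 1)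
    (hy0 : y 0 = x) (hb : HasDerivWithinAt y b (Ioi 0) 0) :
    HasDerivWithinAt (fun s : ℝ => ‖x + s • b‖) 0 (Ioi 0) 0 := by
  have h1 : HasDerivWithinAt (fun s : ℝ => x + s • b) b (Ioi 0) 0 := by
    simpa using ((hasDerivWithinAt_id (0 : ℝ) (Ioi 0)).smul_const b).const_add x
  have h2 := h1.fun_sub hb
  rw [hasDerivWithinAt_iff_isLittleO] at h2 ⊢
  refine Asymptotics.IsBigO.trans_isLittleO (.of_bound 1 (.of_forall fun s => ?_)) h2
  simp only [zero_smul, add_zero, hy0, sub_self, smul_zero, sub_zero, one_mul]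
  rw [← hy0, hy 0, ← hy s]
  exact abs_norm_sub_norm_le _ _

/-- A tangent direction of the unit sphere at `x` is Birkhoff orthogonal to `x`. -/
theorem one_le_norm_add_smul_tangent {x b : X} {y : ℝ → X} (hy : ∀ s, ‖y s‖ = 1) (hy0 : y 0 = x)
    (hb : HasDerivWithinAt y b (Ioi 0) 0) (t : ℝ) : 1 ≤ ‖x + t • b‖ := by
  have h1 := hasDerivWithinAt_norm_line_tangent hy hy0 hb
  have := (convexOn_norm_line x b).isMinOn_of_rightDeriv_eq_zero (x := 0) (by simp)
    (h1.derivWithin (uniqueDiffWithinAt_Ioi 0))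
  have := this (mem_univ t)
  simpa [← hy0, hy] using this

/-- If `x` lies opposite to the cone of two tangent directions at `x`, every ray from `x` into
the interior of that cone meets the unit sphere again. -/
theorem exists_norm_add_smul_eq_one {x bp bm : X} {k l u v : ℝ} (hk : 0 < k) (hl : 0 < l)
    (hu : 0 < u) (hv : 0 < v) (hx : ‖x‖ = 1) (hxb : x = -(k • bp + l • bm))
    (hp : HasDerivWithinAt (fun s : ℝ => ‖x + s • bp‖) 0 (Ioi 0) 0)
    (hm : HasDerivWithinAt (fun s : ℝ => ‖x + s • bm‖) 0 (Ioi 0) 0) :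
    ∃ r : ℝ, 0 < r ∧ ‖x + r • (u • bp + v • bm)‖ = 1 := by
  obtain ⟨δ, hδ, hδu, hδv⟩ : ∃ δ > 0, 0 < u - δ * k ∧ 0 < v - δ * l := by
    refine ⟨min (u / k) (v / l) / 2, by positivity, ?_, ?_⟩
    · have := (le_div_iff₀ hk).1 (min_le_left (u / k) (v / l))
      have : 0 < min (u / k) (v / l) * k := by positivity
      linarith
    · have := (le_div_iff₀ hl).1 (min_le_right (u / k) (v / l))
      have : 0 < min (u / k) (v / l) * l := by positivity
      linarith
  set w := u • bp + v • bm with hw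
  clear_value w
  have key : ∀ (b : X) (a : ℝ), 0 < a → HasDerivWithinAt (fun s : ℝ => ‖x + s • b‖) 0 (Ioi 0) 0 →
      ∀ᶠ s in 𝓝[>] (0 : ℝ), ‖x + (a * s) • b‖ < 1 + s * δ := by
    intro b a ha hb
    have hmaps : MapsTo (fun s : ℝ => a * s) (Ioi 0) (Ioi 0) := fun s hs => mul_pos ha hs
    have hlin : HasDerivWithinAt (fun s : ℝ => a * s) a (Ioi 0) 0 := by
      simpa using (hasDerivWithinAt_id (0 : ℝ) (Ioi 0)).const_mul a
    have := HasDerivWithinAt.comp (h := fun s : ℝ => a * s) (0 : ℝ) (by simpa using hb) hlin hmaps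
    rw [hasDerivWithinAt_iff_tendsto_slope' (by simp)] at this
    filter_upwards [this.eventually (gt_mem_nhds (by simpa using hδ)), self_mem_nhdsWithin]
      with s hs hs0
    have hs0 : (0 : ℝ) < s := hs0
    simp only [slope_def_field, Function.comp, sub_zero, mul_zero, zero_smul, add_zero, hx,
      div_lt_iff₀ hs0] at hs
    linarith
  obtain ⟨s, ⟨hs1, hs2⟩, hs0⟩ := (((key bp (2 * (u - δ * k)) (by positivity) hp).and
    (key bm (2 * (v - δ * l)) (by positivity) hm)).and self_mem_nhdsWithin).exists
  have hs0 : (0 : ℝ) < s := hs0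
  have hpos : 0 < 1 + s * δ := by positivity
  have hz : x + (s / (1 + s * δ)) • w =
      (1 + s * δ)⁻¹ • ((1 / 2 : ℝ) • (x + (2 * (u - δ * k) * s) • bp)
      + (1 / 2 : ℝ) • (x + (2 * (v - δ * l) * s) • bm)) := by
    have h1 : (1 / 2 : ℝ) • (x + (2 * (u - δ * k) * s) • bp)
      + (1 / 2 : ℝ) • (x + (2 * (v - δ * l) * s) • bm) = (1 + s * δ) • x + s • w := by
      have : (s * δ) • x = (s * δ) • (-(k • bp + l • bm)) := by rw [← hxb]
      rw [add_smul, this, hw]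
      module
    rw [h1, smul_add, smul_smul, smul_smul, inv_mul_cancel₀ hpos.ne', one_smul, div_eq_inv_mul]
  have hlt : ‖x + (s / (1 + s * δ)) • w‖ < 1 := by
    rw [hz, norm_smul, norm_inv, Real.norm_of_nonneg hpos.le, inv_mul_lt_iff₀ hpos, mul_one]
    refine (norm_add_le _ _).trans_lt ?_
    rw [norm_smul, norm_smul]
    norm_num
    linarith
  have hw0 : 0 < ‖w‖ := by
    rw [norm_pos_iff]
    rintro h
    simp [h, hx] at hlt
  have hr0 : 0 < s / (1 + s * δ) := by positivity
  have hge : 1 ≤ ‖x + (s / (1 + s * δ) + 2 / ‖w‖) • w‖ := by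
    have h1 : ‖(s / (1 + s * δ) + 2 / ‖w‖) • w‖ = (s / (1 + s * δ)) * ‖w‖ + 2 := by
      rw [norm_smul, Real.norm_of_nonneg (by positivity), add_mul, div_mul_cancel₀ _ hw0.ne']
    have h2 := norm_sub_norm_le ((s / (1 + s * δ) + 2 / ‖w‖) • w) (-x)
    rw [sub_neg_eq_add, norm_neg, hx, h1, add_comm _ x] at h2
    have : 0 < (s / (1 + s * δ)) * ‖w‖ := by positivity
    linarith
  obtain ⟨r, hr, hr1⟩ := intermediate_value_Icc (f := fun r : ℝ => ‖x + r • w‖)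
    (show s / (1 + s * δ) ≤ s / (1 + s * δ) + 2 / ‖w‖ by
      have : 0 < 2 / ‖w‖ := by positivity
      linarith)
    (by fun_prop) ⟨hlt.le, hge⟩
  exact ⟨r, hr0.trans_le hr.1, hr1⟩

/-- `y` is a curve on the unit sphere that starts at `x` with right derivative `b`. -/
structure IsTangentCurve (y : ℝ → sphere (0 : X) 1) (x : sphere (0 : X) 1) (b : X) : Prop where
  start : y 0 = x
  deriv : HasDerivWithinAt (fun s => (y s : X)) b (Ioi 0) 0

theorem IsTangentCurve.hasDerivWithinAt_norm_line {y : ℝ → sphere (0 : X) 1}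
    {x : sphere (0 : X) 1} {b : X} (h : IsTangentCurve y x b) :
    HasDerivWithinAt (fun s : ℝ => ‖(x : X) + s • b‖) 0 (Ioi 0) 0 :=
  hasDerivWithinAt_norm_line_tangent (y := fun s => (y s : X)) (fun s => by simp)
    (by simp [h.start]) h.deriv

theorem IsTangentCurve.one_le_norm {y : ℝ → sphere (0 : X) 1}
    {x : sphere (0 : X) 1} {b : X} (h : IsTangentCurve y x b) (t : ℝ) : 1 ≤ ‖(x : X) + t • b‖ :=
  one_le_norm_add_smul_tangent (y := fun s => (y s : X)) (fun s => by simp)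
    (by simp [h.start]) h.deriv t

theorem norm_deriv_eq_of_norm_eq {Y : Type*} [NormedAddCommGroup Y] [NormedSpace ℝ Y]
    {d : ℝ → X} {d' : ℝ → Y} {w : X} {w' : Y} (hd : HasDerivWithinAt d w (Ioi 0) 0)
    (hd' : HasDerivWithinAt d' w' (Ioi 0) 0) (h : ∀ s, ‖d s - d 0‖ = ‖d' s - d' 0‖) :
    ‖w‖ = ‖w'‖ := by
  rw [hasDerivWithinAt_iff_tendsto_slope' (by simp)] at hd hd'
  refine tendsto_nhds_unique hd.norm (hd'.norm.congr fun s => ?_)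
  simp [slope_def_module, norm_smul, h]

end Tangents

theorem Isometry.norm_sphere_sub {X Y : Type*} [NormedAddCommGroup X] [NormedAddCommGroup Y]
    {f : sphere (0 : X) 1 → sphere (0 : Y) 1} (hf : Isometry f) (p q : sphere (0 : X) 1) :
    ‖(f p : Y) - f q‖ = ‖(p : X) - q‖ := by
  rw [← dist_eq_norm, ← dist_eq_norm]
  exact hf.dist_eq p q

section Corner

variable {X Y : Type*} [NormedAddCommGroup X] [NormedSpace ℝ X] [NormedAddCommGroup Y]
  [NormedSpace ℝ Y] {f : sphere (0 : X) 1 → sphere (0 : Y) 1} {yp ym : ℝ → sphere (0 : X) 1}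
  {x : sphere (0 : X) 1} {bp bm : X} {bp' bm' : Y}

theorem HasDerivWithinAt.comp_const_mul {y : ℝ → X} {b : X}
    (h : HasDerivWithinAt y b (Ioi 0) 0) {u : ℝ} (hu : 0 < u) :
    HasDerivWithinAt (fun s => y (u * s)) (u • b) (Ioi 0) 0 := by
  have hlin : HasDerivWithinAt (fun s : ℝ => u * s) u (Ioi 0) 0 := by
    simpa using (hasDerivWithinAt_id (0 : ℝ) (Ioi 0)).const_mul u
  exact HasDerivWithinAt.scomp (h := fun s : ℝ => u * s) (t' := Ioi 0) (0 : ℝ) (by simpa using h)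
    hlin fun s hs => mul_pos hu hs

theorem norm_smul_sub_smul_eq (hf : Isometry f) (hp : IsTangentCurve yp x bp)
    (hm : IsTangentCurve ym x bm) (hp' : IsTangentCurve (f ∘ yp) (f x) bp')
    (hm' : IsTangentCurve (f ∘ ym) (f x) bm') {u v : ℝ} (hu : 0 < u) (hv : 0 < v) :
    ‖u • bp - v • bm‖ = ‖u • bp' - v • bm'‖ := by
  refine norm_deriv_eq_of_norm_eq ((hp.deriv.comp_const_mul hu).sub (hm.deriv.comp_const_mul hv))
    ((hp'.deriv.comp_const_mul hu).sub (hm'.deriv.comp_const_mul hv)) fun s => ?_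
  simp [hp.start, hm.start, hf.norm_sphere_sub]

/-- The norm of a smooth vector in the corner cone is bounded by that of its image. -/
theorem norm_le_of_differentiableAt (hf : Isometry f) (hp : IsTangentCurve yp x bp)
    (hm : IsTangentCurve ym x bm) (hp' : IsTangentCurve (f ∘ yp) (f x) bp')
    (hm' : IsTangentCurve (f ∘ ym) (f x) bm') {k l u v : ℝ} (hk : 0 < k) (hl : 0 < l)
    (hx : (x : X) = -(k • bp + l • bm)) (hu : 0 < u) (hv : 0 < v)
    (hd : DifferentiableAt ℝ (fun w : X => ‖w‖) (u • bp + v • bm)) :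
    ‖u • bp + v • bm‖ ≤ ‖u • bp' + v • bm'‖ := by
  set w := u • bp + v • bm with hw
  obtain ⟨r, hr, hr1⟩ := exists_norm_add_smul_eq_one hk hl hu hv (by simp) hx
    hp.hasDerivWithinAt_norm_line hm.hasDerivWithinAt_norm_line
  rw [← hw] at hr1
  set p : sphere (0 : X) 1 := ⟨x + r • w, by simpa using hr1⟩ with hpdef
  set φ := fderiv ℝ (fun w : X => ‖w‖) w with hφ
  obtain ⟨ψ, hψ, hψx⟩ := exists_dual_vector'' ℝ ((f p : Y) - f x)
  have key : ∀ {y : ℝ → sphere (0 : X) 1} {b : X} {b' : Y}, IsTangentCurve y x b →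
      IsTangentCurve (f ∘ y) (f x) b' → φ b ≤ ψ b' := by
    intro y b b' hy hy'
    have h1 : HasDerivWithinAt (fun s => (p : X) - y s) (-b) (Ioi 0) 0 := hy.deriv.const_sub _
    have h2 : HasDerivWithinAt (fun s => r⁻¹ • ((p : X) - y s)) (r⁻¹ • (-b)) (Ioi 0) 0 :=
      h1.const_smul _
    have hw0 : r⁻¹ • ((p : X) - y 0) = w := by
      simp [hpdef, hy.start, smul_smul, hr.ne']
    have h3 : HasDerivWithinAt (fun s => ‖r⁻¹ • ((p : X) - y s)‖) (φ (r⁻¹ • (-b))) (Ioi 0) 0 :=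
      HasFDerivAt.comp_hasDerivWithinAt (l := fun w : X => ‖w‖)
        (f := fun s => r⁻¹ • ((p : X) - y s)) (0 : ℝ)
        (by rw [hw0]; exact hd.hasFDerivAt) h2
    have h4 := h3.const_mul r
    have h5 : HasDerivWithinAt (fun s => ψ ((f p : Y) - f (y s))) (ψ (-b')) (Ioi 0) 0 :=
      ψ.hasFDerivAt.comp_hasDerivWithinAt (f := fun s => (f p : Y) - f (y s)) (0 : ℝ)
        (hy'.deriv.const_sub _)
    have h6 : ∀ s, r * ‖r⁻¹ • ((p : X) - y s)‖ = ‖(f p : Y) - f (y s)‖ := fun s => by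
      rw [norm_smul, hf.norm_sphere_sub, norm_inv, Real.norm_of_nonneg hr.le,
        mul_inv_cancel_left₀ hr.ne']
    have := le_of_hasDerivWithinAt_Ioi h5 h4 (by rw [h6, hy.start, hψx]; rfl) fun s _ => by
      rw [h6]
      exact (le_abs_self _).trans ((ψ.le_of_opNorm_le hψ _).trans_eq (one_mul _))
    simp only [map_neg, map_smul, smul_neg, smul_eq_mul, mul_neg, mul_inv_cancel_left₀ hr.ne',
      neg_le_neg_iff] at this
    exact this
  calc ‖w‖ = φ w := hd.fderiv_norm_self.symm
    _ = u * φ bp + v * φ bm := by simp [hw]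
    _ ≤ u * ψ bp' + v * ψ bm' := by
      have := key hp hp'
      have := key hm hm'
      gcongr
    _ = ψ (u • bp' + v • bm') := by simp
    _ ≤ 1 * ‖u • bp' + v • bm'‖ := (le_abs_self _).trans (ψ.le_of_opNorm_le hψ _)
    _ = _ := one_mul _

theorem ContinuousLinearMap.apply_complex (E : ℂ →L[ℝ] X) (z : ℂ) :
    E z = z.re • E 1 + z.im • E Complex.I := by
  rw [← map_smul, ← map_smul, ← map_add]
  congr 1
  apply Complex.ext <;> simp

/-- An isometry of spheres does not decrease the norm under the linear map that sends the
tangent directions at a corner to their images. -/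
theorem norm_le_of_corner [FiniteDimensional ℝ X] (E : ℂ ≃L[ℝ] X) (E' : ℂ →L[ℝ] Y)
    (hf : Isometry f) (hp : IsTangentCurve yp x (E 1)) (hm : IsTangentCurve ym x (E Complex.I))
    (hp' : IsTangentCurve (f ∘ yp) (f x) (E' 1))
    (hm' : IsTangentCurve (f ∘ ym) (f x) (E' Complex.I)) {k l : ℝ} (hk : 0 < k) (hl : 0 < l)
    (hx : (x : X) = -(k • E 1 + l • E Complex.I)) (z : ℂ) : ‖E z‖ ≤ ‖E' z‖ := by
  have hre : Dense {z : ℂ | z.re ≠ 0} :=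
    (dense_compl_singleton (0 : ℝ)).preimage Complex.isOpenMap_re
  have him : Dense {z : ℂ | z.im ≠ 0} :=
    (dense_compl_singleton (0 : ℝ)).preimage Complex.isOpenMap_im
  have hdiff : Dense {z : ℂ | DifferentiableAt ℝ (fun w : X => ‖w‖) (E z)} :=
    dense_differentiableAt_norm.preimage E.toHomeomorph.isOpenMap
  have hdense := hdiff.inter_of_isOpen_right (hre.inter_of_isOpen_right him
    (isOpen_ne_fun Complex.continuous_im continuous_const))
    ((isOpen_ne_fun Complex.continuous_re continuous_const).inter
      (isOpen_ne_fun Complex.continuous_im continuous_const))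
  have hclosed : IsClosed {z : ℂ | ‖E z‖ ≤ ‖E' z‖} :=
    isClosed_le (by fun_prop) (by fun_prop)
  refine hclosed.closure_subset_iff.2 ?_ (hdense z)
  rintro z ⟨hzd, hzr, hzi⟩
  have hE : ∀ z : ℂ, E z = z.re • E 1 + z.im • E Complex.I :=
    (E : ℂ →L[ℝ] X).apply_complex
  have hneg : ∀ z : ℂ, DifferentiableAt ℝ (fun w : X => ‖w‖) (E z) → 0 < z.re → z.im ≠ 0 →
      ‖E z‖ ≤ ‖E' z‖ := by
    intro z hzd hzr hzi
    rcases hzi.lt_or_gt with hi | hi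
    · have := norm_smul_sub_smul_eq hf hp hm hp' hm' hzr (neg_pos.2 hi)
      rw [hE, E'.apply_complex]
      simpa using this.le
    · rw [hE] at hzd ⊢
      rw [E'.apply_complex]
      exact norm_le_of_differentiableAt hf hp hm hp' hm' hk hl hx hzr hi hzd
  rcases hzr.lt_or_gt with hr | hr
  · have := hneg (-z) (by
      have hz : DifferentiableAt ℝ (fun w : X => ‖w‖) (E z) := hzd
      have := (differentiableAt_norm_smul (x := E z) (t := (-1 : ℝ)) (by norm_num)).1 hz
      simpa using this) (by simpa using hr) (by simpa using hzi)
    simpa using this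
  · exact hneg z hzd hr hzi

end Corner

section Circle

variable {X : Type*} [NormedAddCommGroup X] [NormedSpace ℝ X]

theorem exists_equiv_complex_of_linearIndependent (hdim : Module.finrank ℝ X = 2) {x e : X}
    (h : LinearIndependent ℝ ![x, e]) : ∃ E : ℂ ≃L[ℝ] X, E 1 = x ∧ E Complex.I = e := by
  have : FiniteDimensional ℝ X := .of_finrank_pos (by omega)
  let b := basisOfLinearIndependentOfCardEqFinrank h (by simp [hdim])
  refine ⟨(Complex.basisOneI.equiv b (Equiv.refl _)).toContinuousLinearEquiv, ?_, ?_⟩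
  · have := Complex.basisOneI.equiv_apply 0 b (Equiv.refl _)
    simpa [b] using this
  · have := Complex.basisOneI.equiv_apply 1 b (Equiv.refl _)
    simpa [b] using this

theorem exists_equiv_complex (hdim : Module.finrank ℝ X = 2) {x : X} (hx : x ≠ 0) :
    ∃ E : ℂ ≃L[ℝ] X, E 1 = x := by
  obtain ⟨e, he⟩ : ∃ e, e ∉ Submodule.span ℝ {x} := by
    by_contra! h
    have h1 := finrank_span_singleton (K := ℝ) hx
    rw [(Submodule.eq_top_iff').2 h, finrank_top] at h1
    omega
  obtain ⟨E, hE, -⟩ := exists_equiv_complex_of_linearIndependent hdim (x := x) (e := e) <| by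
    rw [LinearIndependent.pair_iff' hx]
    exact fun a ha => he (Submodule.mem_span_singleton.2 ⟨a, ha⟩)
  exact ⟨E, hE⟩

/-- The point of the unit sphere on the ray through `E z`. -/
noncomputable def spherePoint (E : ℂ ≃L[ℝ] X) (z : ℂ) (hz : z ≠ 0) : sphere (0 : X) 1 :=
  ⟨‖E z‖⁻¹ • E z, by
    have : ‖E z‖ ≠ 0 := by simpa using hz
    simp [norm_smul, this]⟩

theorem spherePoint_eq_of_smul (E : ℂ ≃L[ℝ] X) {z w : ℂ} (hz : z ≠ 0) (hw : w ≠ 0) {a : ℝ}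
    (ha : 0 < a) (h : w = a • z) : spherePoint E w hw = spherePoint E z hz := by
  subst h
  have h1 : ‖E z‖ ≠ 0 := by simpa using hz
  ext
  simp only [spherePoint, map_smul, norm_smul, smul_smul, Real.norm_of_nonneg ha.le]
  congr 1
  field_simp

theorem spherePoint_symm (E : ℂ ≃L[ℝ] X) (p : sphere (0 : X) 1) (hp : E.symm (p : X) ≠ 0) :
    spherePoint E (E.symm p) hp = p := by
  ext
  simp [spherePoint]

theorem symm_sphere_ne_zero (E : ℂ ≃L[ℝ] X) (p : sphere (0 : X) 1) : E.symm (p : X) ≠ 0 := by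
  simpa using ne_zero_of_mem_unit_sphere p

/-- Parametrization of the unit sphere by angles, starting at the point opposite to `E 1`. -/
noncomputable def circleParam (E : ℂ ≃L[ℝ] X) (t : ℝ) : sphere (0 : X) 1 :=
  spherePoint E (-Complex.exp (t * Complex.I)) (neg_ne_zero.2 (Complex.exp_ne_zero _))

/-- The angle of a point of the unit sphere, measured from the direction of `-E 1`. -/
noncomputable def sphereAngle (E : ℂ ≃L[ℝ] X) (p : sphere (0 : X) 1) : ℝ :=
  Complex.arg (-(E.symm (p : X)))

theorem continuous_circleParam (E : ℂ ≃L[ℝ] X) : Continuous (circleParam E) := by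
  refine Continuous.subtype_mk (Continuous.smul (Continuous.inv₀ ?_ ?_) ?_) _
  · fun_prop
  · intro t
    simp
  · fun_prop

theorem circleParam_sphereAngle (E : ℂ ≃L[ℝ] X) (p : sphere (0 : X) 1) :
    circleParam E (sphereAngle E p) = p := by
  have hp := symm_sphere_ne_zero E p
  conv_rhs => rw [← spherePoint_symm E p hp]
  refine (spherePoint_eq_of_smul E _ _ (a := ‖E.symm (p : X)‖) (norm_pos_iff.2 hp) ?_).symm
  have := Complex.norm_mul_exp_arg_mul_I (-(E.symm (p : X)))
  rw [norm_neg] at this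
  rw [smul_neg, Complex.real_smul, sphereAngle, this, neg_neg]

theorem sphereAngle_injective (E : ℂ ≃L[ℝ] X) : Function.Injective (sphereAngle E) :=
  Function.LeftInverse.injective (circleParam_sphereAngle E)

theorem sphereAngle_circleParam (E : ℂ ≃L[ℝ] X) {t : ℝ} (ht : t ∈ Ioc (-Real.pi) Real.pi) :
    sphereAngle E (circleParam E t) = t := by
  have h0 : 0 < ‖E (-Complex.exp (t * Complex.I))‖ := by simp
  simp only [sphereAngle, circleParam, spherePoint, map_smul,
    ContinuousLinearEquiv.symm_apply_apply, smul_neg, neg_neg, Complex.real_smul]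
  rw [Complex.exp_mul_I] at h0 ⊢
  exact Complex.arg_mul_cos_add_sin_mul_I (inv_pos.2 h0) ht

theorem neg_symm_mem_slitPlane (E : ℂ ≃L[ℝ] X) {x p : sphere (0 : X) 1} (hx : E 1 = x)
    (hp : p ≠ x) : -(E.symm (p : X)) ∈ Complex.slitPlane := by
  rw [Complex.mem_slitPlane_iff]
  by_contra! h
  simp only [Complex.neg_re, Complex.neg_im, neg_nonpos, neg_eq_zero] at h
  apply hp
  rw [← spherePoint_symm E p (symm_sphere_ne_zero E p)]
  have h0 : (E.symm (p : X)).re ≠ 0 := fun h0 =>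
    symm_sphere_ne_zero E p (Complex.ext h0 h.2)
  rw [spherePoint_eq_of_smul E one_ne_zero _ (lt_of_le_of_ne h.1 h0.symm)]
  · ext
    simp [spherePoint, hx]
  · apply Complex.ext <;> simp [h.2]

theorem continuousAt_sphereAngle (E : ℂ ≃L[ℝ] X) {x p : sphere (0 : X) 1} (hx : E 1 = x)
    (hp : p ≠ x) : ContinuousAt (sphereAngle E) p := by
  have h : Continuous fun p : sphere (0 : X) 1 => -(E.symm (p : X)) := by fun_prop
  exact ContinuousAt.comp (f := fun p : sphere (0 : X) 1 => -(E.symm (p : X)))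
    (Complex.continuousAt_arg (neg_symm_mem_slitPlane E hx hp)) h.continuousAt

theorem sphereAngle_mem_Ioo (E : ℂ ≃L[ℝ] X) {x p : sphere (0 : X) 1} (hx : E 1 = x)
    (hp : p ≠ x) : sphereAngle E p ∈ Ioo (-Real.pi) Real.pi :=
  ⟨Complex.neg_pi_lt_arg _, lt_of_le_of_ne (Complex.arg_le_pi _)
    (Complex.mem_slitPlane_iff_arg.1 (neg_symm_mem_slitPlane E hx hp)).1⟩

theorem circleParam_ne (E : ℂ ≃L[ℝ] X) {x : sphere (0 : X) 1} (hx : E 1 = x) {t : ℝ}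
    (ht : t ∈ Ioo (-Real.pi) Real.pi) : circleParam E t ≠ x := by
  intro h
  have h1 := sphereAngle_circleParam E (Ioo_subset_Ioc_self ht)
  have h2 : sphereAngle E x = Real.pi := by simp [sphereAngle, ← hx]
  rw [h, h2] at h1
  exact ht.2.ne h1.symm

theorem one_add_mul_I_ne_zero (s : ℝ) : (1 + s * Complex.I : ℂ) ≠ 0 := fun h => by
  simpa using congrArg Complex.re h

theorem circleParam_arctan (E : ℂ ≃L[ℝ] X) (s : ℝ) :
    circleParam E (-Real.pi + Real.arctan s) =
      spherePoint E (1 + s * Complex.I) (one_add_mul_I_ne_zero s) := by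
  refine spherePoint_eq_of_smul E _ _ (Real.cos_arctan_pos s) ?_
  have hs : Real.sin (Real.arctan s) = Real.cos (Real.arctan s) * s := by
    have := Real.tan_mul_cos (Real.cos_arctan_pos s).ne'
    rw [Real.tan_arctan] at this
    rw [← this, mul_comm]
  rw [Complex.exp_mul_I, ← Complex.ofReal_cos, ← Complex.ofReal_sin, add_comm (-Real.pi),
    ← sub_eq_add_neg, Real.cos_sub_pi, Real.sin_sub_pi, hs]
  push_cast
  rw [Complex.real_smul]
  push_cast
  ring

/-- A self-isometry of the unit sphere of a plane that fixes a point and preserves the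
orientation near it is the identity. -/
theorem isometry_sphere_eq_self (E : ℂ ≃L[ℝ] X) {x : sphere (0 : X) 1} (hx : E 1 = x)
    {g : sphere (0 : X) 1 → sphere (0 : X) 1} (hiso : Isometry g) (hsurj : Function.Surjective g)
    (hgx : g x = x)
    (hg : ∀ᶠ s : ℝ in 𝓝[>] 0,
      0 < (E.symm (g (spherePoint E (1 + s * Complex.I) (one_add_mul_I_ne_zero s)) : X)).im)
    (p : sphere (0 : X) 1) : g p = p := by
  set G : ℝ → ℝ := fun t => sphereAngle E (g (circleParam E t)) with hG
  have hne : ∀ {p}, p ≠ x → g p ≠ x := fun hp h => hp (hiso.injective (h.trans hgx.symm))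
  have hmem : ∀ {t}, t ∈ Ioo (-Real.pi) Real.pi → G t ∈ Ioo (-Real.pi) Real.pi := fun ht =>
    sphereAngle_mem_Ioo E hx (hne (circleParam_ne E hx ht))
  have hparam : ∀ t, circleParam E (G t) = g (circleParam E t) := fun t =>
    circleParam_sphereAngle E _
  have hcont : ContinuousOn G (Ioo (-Real.pi) Real.pi) := fun t ht =>
    (ContinuousAt.comp (f := fun t => g (circleParam E t))
      (continuousAt_sphereAngle E hx (hne (circleParam_ne E hx ht)))
      (hiso.continuous.comp (continuous_circleParam E)).continuousAt).continuousWithinAt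
  have hinj : InjOn G (Ioo (-Real.pi) Real.pi) := fun s hs t ht hst => by
    rw [← sphereAngle_circleParam E (Ioo_subset_Ioc_self hs),
      ← sphereAngle_circleParam E (Ioo_subset_Ioc_self ht),
      hiso.injective (sphereAngle_injective E hst)]
  have hpi := Real.pi_pos
  have hmono : StrictMonoOn G (Ioo (-Real.pi) Real.pi) := by
    refine (hcont.strictMonoOn_of_injOn_Ioo (by linarith) hinj).resolve_right fun hanti => ?_
    have hq : Real.pi / 2 ∈ Ioo (-Real.pi) Real.pi := ⟨by linarith, by linarith⟩
    obtain ⟨q, hgq⟩ := hsurj (circleParam E (Real.pi / 2))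
    set t₀ := sphereAngle E q with ht₀
    have hG0 : G t₀ = Real.pi / 2 := by
      simp only [hG, ht₀, circleParam_sphereAngle, hgq]
      exact sphereAngle_circleParam E (Ioo_subset_Ioc_self hq)
    have ht₀m : t₀ ∈ Ioo (-Real.pi) Real.pi := by
      refine sphereAngle_mem_Ioo E hx fun h => circleParam_ne E hx hq ?_
      rw [← hgx, ← h, hgq]
    have hsmall : ∀ᶠ s in 𝓝[>] (0 : ℝ), Real.arctan s < t₀ + Real.pi :=
      (Real.continuous_arctan.continuousWithinAt.eventually_lt_const
        (by rw [Real.arctan_zero]; linarith [ht₀m.1]))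
    obtain ⟨s, ⟨hs1, hs2⟩, hs0⟩ := ((hg.and hsmall).and self_mem_nhdsWithin).exists
    rw [← circleParam_arctan] at hs1
    set t := -Real.pi + Real.arctan s with ht
    have ht0 : 0 < Real.arctan s := Real.arctan_pos.2 hs0
    have htm : t ∈ Ioo (-Real.pi) Real.pi := ⟨by linarith, by linarith [ht₀m.2]⟩
    have hlt : G t₀ < G t := hanti htm ht₀m (by linarith)
    have := Complex.arg_nonneg_iff.1 (show 0 ≤ G t by linarith)
    rw [Complex.neg_im] at this
    linarith
  rcases eq_or_ne p x with rfl | hp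
  · exact hgx
  set t : ℕ → ℝ := fun n => G^[n] (sphereAngle E p) with ht
  have htsucc : ∀ n, t (n + 1) = G (t n) := fun n => Function.iterate_succ_apply' G n _
  have htm : ∀ n, t n ∈ Ioo (-Real.pi) Real.pi := fun n => by
    induction n with
    | zero => exact sphereAngle_mem_Ioo E hx hp
    | succ n ih => rw [htsucc]; exact hmem ih
  have ht0 : circleParam E (t 0) = p := circleParam_sphereAngle E p
  have hstep : ∀ n, circleParam E (t (n + 1)) = g (circleParam E (t n)) := fun n => by
    rw [htsucc, hparam]
  have hdist : ∀ n, dist (circleParam E (t (n + 1))) (circleParam E (t n)) = dist (g p) p :=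
    fun n => by
      induction n with
      | zero => rw [hstep, ht0]
      | succ n ih => rw [hstep (n + 1), hstep n, hiso.dist_eq, ← hstep n, ih]
  obtain ⟨τ, hτ⟩ : ∃ τ, Tendsto t atTop (𝓝 τ) := by
    rcases le_total (t 0) (t 1) with h | h
    · have hm : Monotone t := monotone_nat_of_le_succ fun n => by
        induction n with
        | zero => exact h
        | succ n ih =>
          rw [htsucc n, htsucc (n + 1)]
          exact hmono.monotoneOn (htm _) (htm _) ih
      exact ⟨_, tendsto_atTop_ciSup hm ⟨Real.pi, by rintro _ ⟨n, rfl⟩; exact (htm n).2.le⟩⟩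
    · have hm : Antitone t := antitone_nat_of_succ_le fun n => by
        induction n with
        | zero => exact h
        | succ n ih =>
          rw [htsucc n, htsucc (n + 1)]
          exact hmono.monotoneOn (htm _) (htm _) ih
      exact ⟨_, tendsto_atTop_ciInf hm ⟨-Real.pi, by rintro _ ⟨n, rfl⟩; exact (htm n).1.le⟩⟩
  have hlim := ((continuous_circleParam E).tendsto τ).comp hτ
  have hd := (hlim.comp (tendsto_add_atTop_nat 1)).dist hlim
  rw [dist_self] at hd
  have : dist (g p) p = 0 :=
    tendsto_nhds_unique (tendsto_const_nhds.congr fun n => (hdist n).symm) hd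
  exact dist_eq_zero.1 this

theorem linearIndependent_sphere {x q : sphere (0 : X) 1} (h1 : q ≠ x) (h2 : q ≠ -x) :
    LinearIndependent ℝ ![(x : X), (q : X)] := by
  rw [LinearIndependent.pair_iff' (ne_zero_of_mem_unit_sphere x)]
  intro a ha
  have hn : |a| = 1 := by
    have := congrArg norm ha
    simpa [norm_smul] using this
  rcases (abs_eq zero_le_one).1 hn with rfl | rfl
  · exact h1 (Subtype.ext (by simpa using ha.symm))
  · exact h2 (Subtype.ext (by simpa using ha.symm))

/-- A space whose unit sphere is isometric to that of a plane is a plane. -/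
theorem finrank_eq_two_of_sphere_isometry {Y : Type*} [NormedAddCommGroup Y] [NormedSpace ℝ Y]
    (hdim : Module.finrank ℝ X = 2) (f : sphere (0 : X) 1 ≃ᵢ sphere (0 : Y) 1) :
    Module.finrank ℝ Y = 2 := by
  have : Nontrivial X := Module.nontrivial_of_finrank_pos (R := ℝ) (by omega)
  obtain ⟨x₀, hx₀⟩ := exists_ne (0 : X)
  obtain ⟨E, -⟩ := exists_equiv_complex hdim hx₀
  have hpi := Real.pi_gt_three
  have hinj : ∀ {s t : ℝ}, 0 ≤ s → s ≤ 2 → 0 ≤ t → t ≤ 2 →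
      f (circleParam E s) = f (circleParam E t) → s = t := fun hs hs' ht ht' h => by
    rw [← sphereAngle_circleParam E (t := _) ⟨by linarith, hs'.trans (by linarith)⟩,
      f.injective h, sphereAngle_circleParam E ⟨by linarith, ht'.trans (by linarith)⟩]
  obtain ⟨x, q, h1, h2⟩ : ∃ x q : sphere (0 : Y) 1, q ≠ x ∧ q ≠ -x := by
    by_cases h : f (circleParam E 1) = -f (circleParam E 0)
    · refine ⟨f (circleParam E 0), f (circleParam E 2), fun h' => ?_, fun h' => ?_⟩
      · have := hinj (by norm_num) (by norm_num) (by norm_num) (by norm_num) h'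
        norm_num at this
      · have := hinj (by norm_num) (by norm_num) (by norm_num) (by norm_num) (h'.trans h.symm)
        norm_num at this
    · refine ⟨f (circleParam E 0), f (circleParam E 1), fun h' => ?_, h⟩
      have := hinj (by norm_num) (by norm_num) (by norm_num) (by norm_num) h'
      norm_num at this
  have hli := linearIndependent_sphere h1 h2
  set Z := Submodule.span ℝ (range ![(x : Y), (q : Y)]) with hZ
  have hZ2 : Module.finrank ℝ Z = 2 := by
    simpa using finrank_span_eq_card hli
  have hZt : Z = ⊤ := by
    by_contra hne
    obtain ⟨y, -, hy⟩ := SetLike.exists_of_lt (lt_top_iff_ne_top.2 hne)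
    have hy0 : y ≠ 0 := fun h => hy (h ▸ Z.zero_mem)
    set y₀ : sphere (0 : Y) 1 := ⟨‖y‖⁻¹ • y, by simp [norm_smul, hy0]⟩ with hy₀
    obtain ⟨E₀, hE₀⟩ := exists_equiv_complex hdim (ne_zero_of_mem_unit_sphere (f.symm y₀))
    let i : sphere (0 : Z) 1 → sphere (0 : Y) 1 := fun z =>
      ⟨(z : Z), mem_sphere_zero_iff_norm.2 (norm_eq_of_mem_sphere z)⟩
    have hi : Continuous i := by fun_prop
    have hiy : ∀ z, f.symm (i z) ≠ f.symm y₀ := fun z hz => by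
      have h3 : ((z : Z) : Y) = ‖y‖⁻¹ • y := congrArg Subtype.val (f.symm.injective hz)
      have h4 : ‖y‖⁻¹ • y ∈ Z := h3 ▸ (z : Z).2
      exact hy ((Z.smul_mem_iff (by simpa using hy0)).1 h4)
    let h : sphere (0 : Z) 1 → ℝ := fun z => sphereAngle E₀ (f.symm (i z))
    have hh : Continuous h := continuous_iff_continuousAt.2 fun z =>
      ContinuousAt.comp (f := fun z => f.symm (i z)) (continuousAt_sphereAngle E₀ hE₀ (hiy z))
        (f.symm.continuous.comp hi).continuousAt
    have hrank : 1 < Module.rank ℝ Z := by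
      have : FiniteDimensional ℝ Z := .of_finrank_pos (by omega)
      rw [← Module.finrank_eq_rank, hZ2]
      norm_num
    have hconn : PreconnectedSpace (sphere (0 : Z) 1) :=
      isPreconnected_iff_preconnectedSpace.1 (isPreconnected_sphere hrank 0 1)
    have : Nontrivial Z := Module.nontrivial_of_finrank_pos (R := ℝ) (by omega)
    obtain ⟨z₁, hz₁⟩ := (NormedSpace.sphere_nonempty (E := Z) (x := 0) (r := 1)).2 zero_le_one
    let z₀ : sphere (0 : Z) 1 := ⟨z₁, hz₁⟩
    have hd : Continuous fun z => h z - h (-z) := hh.sub (hh.comp continuous_neg)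
    obtain ⟨z, hz⟩ : (0 : ℝ) ∈ range fun z => h z - h (-z) := by
      rcases le_total (h z₀ - h (-z₀)) 0 with h0 | h0
      · exact mem_range_of_exists_le_of_exists_ge hd ⟨z₀, h0⟩ ⟨-z₀, by simp; linarith⟩
      · exact mem_range_of_exists_le_of_exists_ge hd ⟨-z₀, by simp; linarith⟩ ⟨z₀, h0⟩
    have h5 := f.symm.injective (sphereAngle_injective E₀ (sub_eq_zero.1 hz))
    have h6 : ((z : Z) : Y) = -((z : Z) : Y) :=
      congrArg (Subtype.val : sphere (0 : Y) 1 → Y) h5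
    have h7 : ((z : Z) : Y) = 0 := by
      have : (2 : ℝ) • ((z : Z) : Y) = 0 := by
        rw [two_smul]
        nth_rw 1 [h6]
        exact neg_add_cancel _
      simpa using this
    exact ne_zero_of_mem_unit_sphere z (Subtype.ext h7)
  rw [hZt, finrank_top] at hZ2
  exact hZ2

end Circle

section Assembly

variable {X Y : Type*} [NormedAddCommGroup X] [NormedSpace ℝ X] [NormedAddCommGroup Y]
  [NormedSpace ℝ Y]

/-- The curve on the unit sphere that starts at the direction of `E 1` and moves towards
`E Complex.I`. -/
noncomputable def sphereCurve (E : ℂ ≃L[ℝ] X) (s : ℝ) : sphere (0 : X) 1 :=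
  spherePoint E (1 + s * Complex.I) (one_add_mul_I_ne_zero s)

theorem coe_sphereCurve (E : ℂ ≃L[ℝ] X) (s : ℝ) :
    (sphereCurve E s : X) = radialCurve (E 1) (E Complex.I) s := by
  have : E (1 + s * Complex.I) = E 1 + s • E Complex.I := by
    rw [map_add, ← map_smul, Complex.real_smul]
  simp [sphereCurve, spherePoint, radialCurve, this]

theorem continuous_sphereCurve (E : ℂ ≃L[ℝ] X) : Continuous (sphereCurve E) := by
  refine Continuous.subtype_mk (Continuous.smul (Continuous.inv₀ ?_ ?_) ?_) _
  · fun_prop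
  · exact fun s => norm_ne_zero_iff.2 fun h => one_add_mul_I_ne_zero s (E.map_eq_zero_iff.1 h)
  · fun_prop

theorem sphereCurve_zero (E : ℂ ≃L[ℝ] X) {x : sphere (0 : X) 1} (hx : E 1 = x) :
    sphereCurve E 0 = x := by
  ext
  simp [sphereCurve, spherePoint, hx]

theorem sphereCurve_ne (E : ℂ ≃L[ℝ] X) {x : sphere (0 : X) 1} (hx : E 1 = x) {s : ℝ}
    (hs : 0 < s) : sphereCurve E s ≠ x := by
  intro h
  have h0 : ‖E (1 + s * Complex.I)‖ ≠ 0 :=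
    norm_ne_zero_iff.2 fun h => one_add_mul_I_ne_zero s (E.map_eq_zero_iff.1 h)
  have h1 : (sphereCurve E s : X) = E 1 := by rw [h, hx]
  have h2 := congrArg (fun v => (E.symm v).im) h1
  simp only [sphereCurve, spherePoint, map_smul, ContinuousLinearEquiv.symm_apply_apply] at h2
  generalize ‖E (1 + s * Complex.I)‖ = N at h0 h2
  simp [h0, hs.ne'] at h2

theorem isTangentCurve_sphereCurve (E : ℂ ≃L[ℝ] X) {x : sphere (0 : X) 1} (hx : E 1 = x) {c : ℝ}
    (hc : HasDerivWithinAt (fun s : ℝ => ‖(x : X) + s • E Complex.I‖) c (Ioi 0) 0) :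
    IsTangentCurve (sphereCurve E) x (E Complex.I - c • (x : X)) where
  start := sphereCurve_zero E hx
  deriv := by
    simp only [coe_sphereCurve, hx]
    exact hasDerivWithinAt_radialCurve (by simp) hc

/-- A curve on the unit sphere of a plane that leaves `x` on one side and has a speed at `x`
has a right derivative there. -/
theorem exists_isTangentCurve_of_im_pos (E : ℂ ≃L[ℝ] X) {x : sphere (0 : X) 1} (hx : E 1 = x)
    {q : ℝ → sphere (0 : X) 1} (hq0 : q 0 = x)
    (hpos : ∀ᶠ s in 𝓝[>] (0 : ℝ), 0 < (E.symm (q s : X)).im) {v : ℝ} (hv : 0 < v)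
    (hlim : Tendsto (fun s : ℝ => ‖(q s : X) - x‖ / s) (𝓝[>] 0) (𝓝 v)) {c : ℝ}
    (hc : HasDerivWithinAt (fun s : ℝ => ‖(x : X) + s • E Complex.I‖) c (Ioi 0) 0) :
    ∃ k : ℝ, 0 < k ∧ IsTangentCurve q x (k • (E Complex.I - c • (x : X))) := by
  set b := E Complex.I - c • (x : X) with hb
  have hb0 : 0 < ‖b‖ := by
    rw [norm_pos_iff, hb, ← hx, ← map_smul, ← map_sub]
    intro h
    have := congrArg Complex.im (E.map_eq_zero_iff.1 h)
    simp at this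
  have hid : Tendsto (fun s : ℝ => s) (𝓝[>] 0) (𝓝 0) := nhdsWithin_le_nhds
  have hqx : Tendsto (fun s : ℝ => (q s : X)) (𝓝[>] 0) (𝓝 x) := by
    rw [tendsto_iff_norm_sub_tendsto_zero]
    have := hlim.mul hid
    rw [mul_zero] at this
    refine this.congr' ?_
    filter_upwards [self_mem_nhdsWithin] with s hs
    exact div_mul_cancel₀ _ (ne_of_gt hs)
  have hz : Tendsto (fun s : ℝ => E.symm (q s : X)) (𝓝[>] 0) (𝓝 1) := by
    have := (E.symm.continuous.tendsto (x : X)).comp hqx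
    rwa [← hx, E.symm_apply_apply] at this
  have hre : Tendsto (fun s : ℝ => (E.symm (q s : X)).re) (𝓝[>] 0) (𝓝 1) :=
    (Complex.continuous_re.tendsto 1).comp hz
  have him : Tendsto (fun s : ℝ => (E.symm (q s : X)).im) (𝓝[>] 0) (𝓝 0) :=
    (Complex.continuous_im.tendsto 1).comp hz
  have hrepos : ∀ᶠ s in 𝓝[>] (0 : ℝ), 0 < (E.symm (q s : X)).re :=
    hre.eventually (lt_mem_nhds one_pos)
  set τ : ℝ → ℝ := fun s => (E.symm (q s : X)).im / (E.symm (q s : X)).re with hτ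
  have hτ0 : Tendsto τ (𝓝[>] 0) (𝓝[>] 0) := by
    refine tendsto_nhdsWithin_iff.2 ⟨?_, ?_⟩
    · have := him.div hre one_ne_zero
      rwa [zero_div] at this
    filter_upwards [hpos, hrepos] with s h1 h2 using div_pos h1 h2
  have hqτ : ∀ᶠ s in 𝓝[>] (0 : ℝ), q s = sphereCurve E (τ s) := by
    filter_upwards [hrepos] with s h2
    rw [← spherePoint_symm E (q s) (symm_sphere_ne_zero E _)]
    refine spherePoint_eq_of_smul E _ _ h2 ?_
    apply Complex.ext
    · simp
    · simp [hτ, mul_div_cancel₀ _ h2.ne']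
  have hslope := (hasDerivWithinAt_iff_tendsto_slope' (by simp)).1
    (isTangentCurve_sphereCurve E hx hc).deriv
  have h1 : Tendsto (fun s => (τ s)⁻¹ • ((q s : X) - x)) (𝓝[>] 0) (𝓝 b) := by
    refine (hslope.comp hτ0).congr' ?_
    filter_upwards [hqτ] with s hs
    simp [slope_def_module, sphereCurve_zero E hx, hs]
  have h2 : Tendsto (fun s => (‖(q s : X) - x‖ / s) / ‖(τ s)⁻¹ • ((q s : X) - x)‖) (𝓝[>] 0)
      (𝓝 (v / ‖b‖)) := hlim.div h1.norm hb0.ne'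
  refine ⟨v / ‖b‖, by positivity, hq0, ?_⟩
  rw [hasDerivWithinAt_iff_tendsto_slope' (by simp)]
  refine (h2.smul h1).congr' ?_
  have hqne : ∀ᶠ s in 𝓝[>] (0 : ℝ), 0 < ‖(q s : X) - x‖ / s :=
    hlim.eventually (lt_mem_nhds hv)
  filter_upwards [self_mem_nhdsWithin, hqne, hτ0 self_mem_nhdsWithin] with s hs hqs hτs
  have hs : (0 : ℝ) < s := hs
  have hτs : 0 < τ s := hτs
  have hn : ‖(q s : X) - x‖ ≠ 0 := fun h => by simp [h] at hqs
  rw [smul_smul, slope_def_module, hq0, sub_zero, norm_smul, norm_inv, Real.norm_of_nonneg hτs.le]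
  congr 1
  field_simp

/-- The plane coordinates `E` reflected in the line of `E 1`. -/
noncomputable def conjCoord (E : ℂ ≃L[ℝ] X) : ℂ ≃L[ℝ] X :=
  Complex.conjCLE.trans E

@[simp]
theorem conjCoord_one (E : ℂ ≃L[ℝ] X) : conjCoord E 1 = E 1 := by simp [conjCoord]

@[simp]
theorem conjCoord_I (E : ℂ ≃L[ℝ] X) : conjCoord E Complex.I = -E Complex.I := by simp [conjCoord]

theorem im_conjCoord_symm (E : ℂ ≃L[ℝ] X) (v : X) :
    ((conjCoord E).symm v).im = -(E.symm v).im := by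
  obtain ⟨z, rfl⟩ := (conjCoord E).surjective v
  rw [ContinuousLinearEquiv.symm_apply_apply]
  simp [conjCoord]

/-- The image of the curve `sphereCurve E` under an isometry of spheres of planes has a right
derivative. -/
theorem exists_isTangentCurve_image {f : sphere (0 : X) 1 → sphere (0 : Y) 1} (hf : Isometry f)
    (E : ℂ ≃L[ℝ] X) (E' : ℂ ≃L[ℝ] Y) {x : sphere (0 : X) 1} (hx : E 1 = x) (hx' : E' 1 = f x) :
    ∃ e' : Y, (e' = E' Complex.I ∨ e' = -E' Complex.I) ∧ ∀ c : ℝ,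
      HasDerivWithinAt (fun s : ℝ => ‖(f x : Y) + s • e'‖) c (Ioi 0) 0 →
      ∃ k : ℝ, 0 < k ∧ IsTangentCurve (f ∘ sphereCurve E) (f x) (k • (e' - c • (f x : Y))) := by
  obtain ⟨c₀, hc₀⟩ := exists_hasDerivWithinAt_norm_line (x : X) (E Complex.I)
  have htan := isTangentCurve_sphereCurve E hx hc₀
  have hb0 : 0 < ‖E Complex.I - c₀ • (x : X)‖ := by
    rw [norm_pos_iff, ← hx, ← map_smul, ← map_sub]
    intro h
    have := congrArg Complex.im (E.map_eq_zero_iff.1 h)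
    simp at this
  have hlim : Tendsto (fun s : ℝ => ‖((f ∘ sphereCurve E) s : Y) - f x‖ / s) (𝓝[>] 0)
      (𝓝 ‖E Complex.I - c₀ • (x : X)‖) := by
    refine ((hasDerivWithinAt_iff_tendsto_slope' (by simp)).1 htan.deriv).norm.congr' ?_
    filter_upwards [self_mem_nhdsWithin] with s hs
    have hs : (0 : ℝ) < s := hs
    simp only [slope_def_module, htan.start, sub_zero, norm_smul, norm_inv, Function.comp,
      hf.norm_sphere_sub, Real.norm_of_nonneg hs.le]
    rw [div_eq_inv_mul]
  have hcont : Continuous fun s => (E'.symm (f (sphereCurve E s) : Y)).im := by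
    have := hf.continuous.comp (continuous_sphereCurve E)
    exact Complex.continuous_im.comp (E'.symm.continuous.comp (continuous_subtype_val.comp this))
  obtain ⟨δ, hδ, hsmall⟩ : ∃ δ > 0, ∀ s ∈ Ioo (0 : ℝ) δ, ‖(sphereCurve E s : X) - x‖ < 2 := by
    have h1 : Continuous fun s => ‖(sphereCurve E s : X) - x‖ :=
      ((continuous_subtype_val.comp (continuous_sphereCurve E)).sub continuous_const).norm
    have h2 : ∀ᶠ s in 𝓝[>] (0 : ℝ), ‖(sphereCurve E s : X) - x‖ < 2 :=
      h1.continuousWithinAt.eventually_lt_const (by simp [sphereCurve_zero E hx])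
    obtain ⟨δ, hδ, h⟩ := mem_nhdsGT_iff_exists_Ioo_subset.1 h2
    exact ⟨δ, hδ, h⟩
  have hne : ∀ s ∈ Ioo (0 : ℝ) δ, (E'.symm (f (sphereCurve E s) : Y)).im ≠ 0 := by
    intro s hs h0
    by_cases h : f (sphereCurve E s) = -f x
    · have h1 := hsmall s hs
      rw [← hf.norm_sphere_sub, h] at h1
      have h2 : ((-f x : sphere (0 : Y) 1) : Y) - f x = (-2 : ℝ) • (f x : Y) := by
        simp only [coe_neg_sphere]
        module
      rw [h2, norm_smul] at h1
      simp at h1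
    · have hli := linearIndependent_sphere
        (fun h' => sphereCurve_ne E hx hs.1 (hf.injective h')) h
      rw [LinearIndependent.pair_iff' (ne_zero_of_mem_unit_sphere _)] at hli
      refine hli (E'.symm (f (sphereCurve E s) : Y)).re ?_
      rw [← hx', ← map_smul]
      refine E'.symm.injective ?_
      rw [E'.symm_apply_apply]
      apply Complex.ext <;> simp [h0]
  have hmem : Ioo 0 δ ∈ 𝓝[>] (0 : ℝ) := Ioo_mem_nhdsGT hδ
  have hsign : (∀ s ∈ Ioo (0 : ℝ) δ, 0 < (E'.symm (f (sphereCurve E s) : Y)).im) ∨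
      ∀ s ∈ Ioo (0 : ℝ) δ, (E'.symm (f (sphereCurve E s) : Y)).im < 0 := by
    by_contra! h
    obtain ⟨⟨s, hs, hs'⟩, t, ht, ht'⟩ := h
    obtain ⟨r, hr, hr'⟩ := isPreconnected_Ioo.intermediate_value hs ht hcont.continuousOn ⟨hs', ht'⟩
    exact hne r hr hr'
  have h0 : (f ∘ sphereCurve E) 0 = f x := by simp [sphereCurve_zero E hx]
  rcases hsign with h | h
  · exact ⟨_, .inl rfl, fun c hc => exists_isTangentCurve_of_im_pos E' hx' h0
      (by filter_upwards [hmem] with s hs using h s hs) hb0 hlim hc⟩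
  · refine ⟨_, .inr rfl, fun c hc => ?_⟩
    rw [← conjCoord_I] at hc ⊢
    refine exists_isTangentCurve_of_im_pos (conjCoord E') (by simpa using hx') h0 ?_ hb0 hlim hc
    filter_upwards [hmem] with s hs
    simpa [im_conjCoord_symm] using h s hs

theorem neg_le_coord_of_tangent {x : sphere (0 : X) 1} {y : ℝ → sphere (0 : X) 1} {b b₂ : X}
    (hy : IsTangentCurve y x b₂) {k l : ℝ} (hk : 0 < k) (hx : (x : X) = -(k • b + l • b₂))
    {r t : ℝ} (hp : ‖r • b + t • b₂‖ = 1) : -k ≤ r := by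
  by_contra! h
  have ha : 1 < -r / k := by rw [lt_div_iff₀ hk]; linarith
  set a := -r / k with hadef
  have hrk : r = -(a * k) := by rw [hadef]; field_simp
  have h1 : r • b + t • b₂ = a • ((x : X) + (l + t / a) • b₂) := by
    have ha0 : a * (t / a) = t := mul_div_cancel₀ _ (by linarith)
    rw [hx, hrk]
    nth_rw 1 [← ha0]
    module
  rw [h1, norm_smul, Real.norm_of_nonneg (by linarith)] at hp
  have := hy.one_le_norm (l + t / a)
  nlinarith

theorem exists_direction_of_not_isSmoothPoint {x : X} (hx : ‖x‖ = 1) (h : ¬ IsSmoothPoint x) :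
    ∃ e : X, LinearIndependent ℝ ![x, e] ∧ ∀ c c' : ℝ,
      HasDerivWithinAt (fun s : ℝ => ‖x + s • e‖) c (Ioi 0) 0 →
      HasDerivWithinAt (fun s : ℝ => ‖x + s • -e‖) c' (Ioi 0) 0 → 0 < c + c' := by
  have hx0 : x ≠ 0 := fun h => by simp [h] at hx
  obtain ⟨g₁, hg₁, hg₁x⟩ := exists_dual_vector ℝ x (by simp [hx])
  replace hg₁x : g₁ x = ‖x‖ := hg₁x
  obtain ⟨g₂, hg₂, hne⟩ : ∃ g₂ : X →L[ℝ] ℝ, (g₂ x = 1 ∧ ‖g₂‖ = 1) ∧ g₂ ≠ g₁ := by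
    by_contra! h'
    exact h ⟨g₁, ⟨hg₁x.trans hx, hg₁⟩, h'⟩
  obtain ⟨e, he⟩ : ∃ e, g₂ e ≠ g₁ e := by
    by_contra! h'
    exact hne (ContinuousLinearMap.ext h')
  refine ⟨e, ?_, fun c c' hc hc' => ?_⟩
  · rw [LinearIndependent.pair_iff' hx0]
    rintro a rfl
    simp [hg₁x, hg₂.1, hx] at he
  · have h1 := functional_le_of_hasDerivWithinAt_norm_line hc g₁ hg₁.le hg₁x
    have h2 := functional_le_of_hasDerivWithinAt_norm_line hc g₂ hg₂.2.le (hg₂.1.trans hx.symm)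
    have h3 := functional_le_of_hasDerivWithinAt_norm_line hc' g₁ hg₁.le hg₁x
    have h4 := functional_le_of_hasDerivWithinAt_norm_line hc' g₂ hg₂.2.le (hg₂.1.trans hx.symm)
    rw [map_neg] at h3 h4
    rcases he.lt_or_gt with h | h <;> linarith

end Assembly

section Main

variable {X Y : Type*} [NormedAddCommGroup X] [NormedSpace ℝ X] [NormedAddCommGroup Y]
  [NormedSpace ℝ Y]

theorem eq_neg_corner_combination (x e : X) {c c' k l : ℝ} (hc : c + c' ≠ 0) (hk : k ≠ 0)
    (hl : l ≠ 0) :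
    x = -((k * (c + c'))⁻¹ • k • (e - c • x) + (l * (c + c'))⁻¹ • l • (-e - c' • x)) := by
  have h1 : (k * (c + c'))⁻¹ * k = (c + c')⁻¹ := by field_simp
  have h2 : (l * (c + c'))⁻¹ * l = (c + c')⁻¹ := by field_simp
  have h3 : (c + c')⁻¹ * (c + c') = 1 := inv_mul_cancel₀ hc
  rw [smul_smul, smul_smul, h1, h2]
  nth_rw 1 [← one_smul ℝ x, ← h3]
  module

theorem linearIndependent_corner (E : ℂ ≃L[ℝ] X) {c c' k l : ℝ} (hc : c + c' ≠ 0) (hk : k ≠ 0)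
    (hl : l ≠ 0) :
    LinearIndependent ℝ
      ![k • (E Complex.I - c • E 1), l • (-E Complex.I - c' • E 1)] := by
  rw [LinearIndependent.pair_iff]
  intro s t h
  have h1 : E (s • k • (Complex.I - c • 1) + t • l • (-Complex.I - c' • 1)) = 0 := by
    simpa only [map_add, map_smul, map_sub, map_neg] using h
  rw [E.map_eq_zero_iff] at h1
  have hre := congrArg Complex.re h1
  have him := congrArg Complex.im h1
  simp at hre him
  have h2 : s * k * (c + c') = 0 := by linear_combination -hre + c' * him
  have hs : s = 0 := by simpa [hk, hc] using h2
  subst hs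
  exact ⟨rfl, by simpa [hl] using him⟩

theorem add_nonneg_of_hasDerivWithinAt_norm_line {x e : X} {c c' : ℝ}
    (hc : HasDerivWithinAt (fun s : ℝ => ‖x + s • e‖) c (Ioi 0) 0)
    (hc' : HasDerivWithinAt (fun s : ℝ => ‖x + s • -e‖) c' (Ioi 0) 0) : 0 ≤ c + c' := by
  obtain ⟨g, hg, hgx⟩ := exists_dual_vector'' ℝ x
  have h1 := functional_le_of_hasDerivWithinAt_norm_line hc g hg hgx
  have h2 := functional_le_of_hasDerivWithinAt_norm_line hc' g hg hgx
  rw [map_neg] at h2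
  linarith

/-- A corner of a unit sphere of a plane: coordinates `F` whose axes are the one-sided tangent
directions, along the curves `yp` and `ym`, at the point `x`, which lies in the open cone spanned
by the opposite directions. -/
structure IsSphereCorner (F : ℂ ≃L[ℝ] X) (yp ym : ℝ → sphere (0 : X) 1) (x : sphere (0 : X) 1)
    (k l : ℝ) : Prop where
  left : IsTangentCurve yp x (F 1)
  right : IsTangentCurve ym x (F Complex.I)
  left_pos : 0 < k
  right_pos : 0 < l
  point_eq : (x : X) = -(k • F 1 + l • F Complex.I)

/-- A sphere of a plane has a corner at each nonsmooth point. -/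
theorem exists_isSphereCorner (hdim : Module.finrank ℝ X = 2) {x : sphere (0 : X) 1}
    (hx : ¬ IsSmoothPoint (x : X)) :
    ∃ (E F : ℂ ≃L[ℝ] X) (c k l : ℝ), E 1 = x ∧ F 1 = E Complex.I - c • (x : X) ∧
      IsSphereCorner F (sphereCurve E) (sphereCurve (conjCoord E)) x k l := by
  obtain ⟨e, hli, he⟩ := exists_direction_of_not_isSmoothPoint (by simp) hx
  obtain ⟨E, hE, rfl⟩ := exists_equiv_complex_of_linearIndependent hdim hli
  obtain ⟨c, hc⟩ := exists_hasDerivWithinAt_norm_line (x : X) (E Complex.I)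
  obtain ⟨c', hc'⟩ := exists_hasDerivWithinAt_norm_line (x : X) (-E Complex.I)
  have hpos := he c c' hc hc'
  obtain ⟨F, hF1, hFI⟩ := exists_equiv_complex_of_linearIndependent hdim
    (linearIndependent_corner E hpos.ne' one_ne_zero one_ne_zero)
  rw [one_smul, hE] at hF1 hFI
  refine ⟨E, F, c, (1 * (c + c'))⁻¹, (1 * (c + c'))⁻¹, hE, hF1, ?_, ?_, by simpa, by simpa, ?_⟩
  · rw [hF1]
    exact isTangentCurve_sphereCurve E hE hc
  · rw [hFI, ← conjCoord_I]
    exact isTangentCurve_sphereCurve (conjCoord E) (by simpa) (by simpa using hc')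
  · have := eq_neg_corner_combination (x : X) (E Complex.I) hpos.ne' one_ne_zero one_ne_zero
    rwa [one_smul, one_smul, ← hF1, ← hFI] at this

/-- An isometry of spheres of planes maps a corner to a corner. -/
theorem IsSphereCorner.exists_image (hdimX : Module.finrank ℝ X = 2) (hdim : Module.finrank ℝ Y = 2)
    {f : sphere (0 : X) 1 → sphere (0 : Y) 1} (hf : Isometry f) {E F : ℂ ≃L[ℝ] X}
    {x : sphere (0 : X) 1} {k l : ℝ} (hE : E 1 = x)
    (h : IsSphereCorner F (sphereCurve E) (sphereCurve (conjCoord E)) x k l) :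
    ∃ (F' : ℂ ≃L[ℝ] Y) (k' l' : ℝ),
      IsSphereCorner F' (f ∘ sphereCurve E) (f ∘ sphereCurve (conjCoord E)) (f x) k' l' := by
  have : FiniteDimensional ℝ X := .of_finrank_pos (by omega)
  obtain ⟨E', hE'⟩ := exists_equiv_complex hdim (ne_zero_of_mem_unit_sphere (f x))
  obtain ⟨e₁, he₁, h₁⟩ := exists_isTangentCurve_image hf E E' hE hE'
  obtain ⟨e₂, he₂, h₂⟩ :=
    exists_isTangentCurve_image hf (conjCoord E) E' ((conjCoord_one E).trans hE) hE'
  obtain ⟨c₁, hc₁⟩ := exists_hasDerivWithinAt_norm_line (f x : Y) e₁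
  obtain ⟨k₁, hk₁, ht₁⟩ := h₁ c₁ hc₁
  have hne : e₂ ≠ e₁ := by
    rintro rfl
    obtain ⟨k₂, hk₂, ht₂⟩ := h₂ c₁ hc₁
    have hn := norm_smul_sub_smul_eq hf h.left h.right ht₁ ht₂ hk₂ hk₁
    rw [smul_smul, smul_smul, mul_comm k₂, sub_self, norm_zero, norm_eq_zero, ← map_smul,
      ← map_smul, ← map_sub, F.map_eq_zero_iff] at hn
    have := congrArg Complex.re hn
    simp [hk₂.ne'] at this
  obtain ⟨G, hG1, hGI⟩ : ∃ G : ℂ ≃L[ℝ] Y, G 1 = f x ∧ G Complex.I = e₁ := by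
    rcases he₁ with rfl | rfl
    · exact ⟨E', hE', rfl⟩
    · exact ⟨conjCoord E', by simpa using hE', by simp⟩
  have heq : e₂ = -e₁ := by
    rcases he₁ with rfl | rfl <;> rcases he₂ with rfl | rfl <;> simp_all
  subst heq
  obtain ⟨c₂, hc₂⟩ := exists_hasDerivWithinAt_norm_line (f x : Y) (-e₁)
  obtain ⟨k₂, hk₂, ht₂⟩ := h₂ c₂ hc₂
  set L : ℂ →L[ℝ] Y := Complex.reCLM.smulRight (k₁ • (e₁ - c₁ • (f x : Y))) +
    Complex.imCLM.smulRight (k₂ • (-e₁ - c₂ • (f x : Y))) with hL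
  have hL1 : L 1 = k₁ • (e₁ - c₁ • (f x : Y)) := by simp [hL]
  have hLI : L Complex.I = k₂ • (-e₁ - c₂ • (f x : Y)) := by simp [hL]
  have hle := norm_le_of_corner F L hf h.left h.right (hL1 ▸ ht₁) (hLI ▸ ht₂) h.left_pos
    h.right_pos h.point_eq
  have hc0 : c₁ + c₂ ≠ 0 := by
    intro hc0
    have hz : L ⟨k₁⁻¹, k₂⁻¹⟩ = 0 := by
      rw [L.apply_complex, hL1, hLI, smul_smul, smul_smul, inv_mul_cancel₀ hk₁.ne',
        inv_mul_cancel₀ hk₂.ne', show c₂ = -c₁ by linarith]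
      module
    have := hle ⟨k₁⁻¹, k₂⁻¹⟩
    rw [hz, norm_zero, norm_le_zero_iff, F.map_eq_zero_iff] at this
    have := congrArg Complex.re this
    simp [hk₁.ne'] at this
  have hpos : 0 < c₁ + c₂ :=
    lt_of_le_of_ne (add_nonneg_of_hasDerivWithinAt_norm_line hc₁ hc₂) hc0.symm
  have hli := linearIndependent_corner G hc0 hk₁.ne' hk₂.ne'
  rw [hG1, hGI] at hli
  obtain ⟨F', hF1, hFI⟩ := exists_equiv_complex_of_linearIndependent hdim hli
  have hpoint := eq_neg_corner_combination (f x : Y) e₁ hc0 hk₁.ne' hk₂.ne'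
  rw [← hF1, ← hFI] at hpoint
  exact ⟨F', (k₁ * (c₁ + c₂))⁻¹, (k₂ * (c₁ + c₂))⁻¹, hF1 ▸ ht₁, hFI ▸ ht₂, by positivity,
    by positivity, hpoint⟩

/-- An isometry of spheres of planes that maps a corner to a corner identifies the norms. -/
theorem IsSphereCorner.norm_eq [FiniteDimensional ℝ X] [FiniteDimensional ℝ Y]
    (f : sphere (0 : X) 1 ≃ᵢ sphere (0 : Y) 1) {F : ℂ ≃L[ℝ] X} {F' : ℂ ≃L[ℝ] Y}
    {yp ym : ℝ → sphere (0 : X) 1} {x : sphere (0 : X) 1} {k l k' l' : ℝ}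
    (h : IsSphereCorner F yp ym x k l) (h' : IsSphereCorner F' (f ∘ yp) (f ∘ ym) (f x) k' l') (z : ℂ) :
    ‖F' z‖ = ‖F z‖ := by
  have hs : ∀ y : ℝ → sphere (0 : X) 1, f.symm ∘ f ∘ y = y := fun y => by ext; simp
  refine le_antisymm ?_ ?_
  · exact norm_le_of_corner F' (F : ℂ →L[ℝ] X) f.symm.isometry h'.left h'.right
      (by simpa [hs] using h.left) (by simpa [hs] using h.right) h'.left_pos h'.right_pos
      h'.point_eq z
  · exact norm_le_of_corner F (F' : ℂ →L[ℝ] Y) f.isometry h.left h.right h'.left h'.right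
      h.left_pos h.right_pos h.point_eq z

/-- The coordinates of a corner point are determined by the norm. -/
theorem IsSphereCorner.le_of_norm_eq {F : ℂ ≃L[ℝ] X} {F' : ℂ ≃L[ℝ] Y}
    {yp ym : ℝ → sphere (0 : X) 1} {yp' ym' : ℝ → sphere (0 : Y) 1} {x : sphere (0 : X) 1}
    {x' : sphere (0 : Y) 1} {k l k' l' : ℝ} (h : IsSphereCorner F yp ym x k l)
    (h' : IsSphereCorner F' yp' ym' x' k' l') (hn : ∀ z, ‖F' z‖ = ‖F z‖) : k' ≤ k ∧ l' ≤ l := by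
  have h1 : ‖(-k') • F 1 + (-l') • F Complex.I‖ = 1 := by
    rw [← map_smul, ← map_smul, ← map_add, ← hn, map_add, map_smul, map_smul, neg_smul, neg_smul,
      ← neg_add, ← h'.point_eq]
    simp
  have h2 := neg_le_coord_of_tangent h.right h.left_pos h.point_eq h1
  have h3 := neg_le_coord_of_tangent h.left h.right_pos (h.point_eq.trans (by rw [add_comm]))
    ((congrArg norm (add_comm _ _)).trans h1)
  constructor <;> linarith

end Main

/-- Every non-smooth 2-dimensional real Banach space has the Mazur–Ulam property:
every surjective isometry from its unit sphere onto the unit sphere of an arbitrary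
real Banach space `Y` extends to a bijective linear isometry `X ≃ₗᵢ[ℝ] Y`. -/
theorem nonsmooth_two_dim_mazur_ulam
    {X : Type*} [NormedAddCommGroup X] [NormedSpace ℝ X] [CompleteSpace X]
    (hdim : Module.finrank ℝ X = 2)
    (hnonsmooth : ∃ x ∈ sphere (0 : X) 1, ¬ IsSmoothPoint x)
    (Y : Type*) [NormedAddCommGroup Y] [NormedSpace ℝ Y] [CompleteSpace Y]
    (f : sphere (0 : X) 1 → sphere (0 : Y) 1)
    (hf_iso : Isometry f) (hf_surj : Function.Surjective f) :
    ∃ F : X ≃ₗᵢ[ℝ] Y, ∀ x : sphere (0 : X) 1, F (x : X) = (f x : Y) := by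
  obtain ⟨x, hx1, hx⟩ := hnonsmooth
  lift x to sphere (0 : X) 1 using hx1
  obtain ⟨E, F, c, k, l, hE, hF1, h⟩ := exists_isSphereCorner hdim hx
  let fE : sphere (0 : X) 1 ≃ᵢ sphere (0 : Y) 1 :=
    IsometryEquiv.mk (Equiv.ofBijective f ⟨hf_iso.injective, hf_surj⟩) hf_iso
  have hdimY := finrank_eq_two_of_sphere_isometry hdim fE
  have : FiniteDimensional ℝ X := .of_finrank_pos (by omega)
  have : FiniteDimensional ℝ Y := .of_finrank_pos (by omega)
  obtain ⟨F', k', l', h'⟩ := h.exists_image hdim hdimY hf_iso hE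
  have hn := IsSphereCorner.norm_eq fE h h'
  have hle := h.le_of_norm_eq h' hn
  have hge := h'.le_of_norm_eq h fun z => (hn z).symm
  obtain rfl : k' = k := le_antisymm hle.1 hge.1
  obtain rfl : l' = l := le_antisymm hle.2 hge.2
  let T : X ≃ₗᵢ[ℝ] Y :=
    ⟨(F.symm.trans F').toLinearEquiv, fun v => by
      obtain ⟨z, rfl⟩ := F.surjective v
      simpa using hn z⟩
  have hT : ∀ z, T.symm (F' z) = F z := fun z => by
    rw [LinearIsometryEquiv.symm_apply_eq]
    simp [T]
  have hTx : T.symm (f x : Y) = x := by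
    rw [h'.point_eq, map_neg, map_add, map_smul, map_smul, hT, hT, ← h.point_eq]
  let g : sphere (0 : X) 1 → sphere (0 : X) 1 := fun p => ⟨T.symm (f p : Y), by simp⟩
  have hg_iso : Isometry g := Isometry.of_dist_eq fun p q => by
    simp only [g, Subtype.dist_eq, T.symm.dist_map]
    exact hf_iso.dist_eq p q
  have hg_surj : Function.Surjective g := fun p => by
    obtain ⟨q, hq⟩ := hf_surj ⟨T p, by simp⟩
    exact ⟨q, Subtype.ext (by simp [g, hq])⟩
  have hgx : g x = x := Subtype.ext hTx
  have hder : HasDerivWithinAt (fun s => (E.symm (g (sphereCurve E s) : X)).im) 1 (Ioi 0) 0 := by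
    have h1 := (Complex.imCLM.comp (E.symm.toContinuousLinearMap.comp
      T.symm.toContinuousLinearEquiv.toContinuousLinearMap)).hasFDerivAt.comp_hasDerivWithinAt
        (0 : ℝ) h'.left.deriv
    have h2 : (E.symm (T.symm (F' 1))).im = 1 := by
      rw [hT, hF1, ← hE, ← map_smul, ← map_sub, E.symm_apply_apply]
      simp
    exact h1.congr_deriv h2
  have hg : ∀ᶠ s : ℝ in 𝓝[>] 0, 0 < (E.symm (g (sphereCurve E s) : X)).im := by
    rw [hasDerivWithinAt_iff_tendsto_slope' (by simp)] at hder
    filter_upwards [hder.eventually (lt_mem_nhds one_pos), self_mem_nhdsWithin] with s hs hs0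
    have hs0 : (0 : ℝ) < s := hs0
    rw [slope_def_field, sphereCurve_zero E hE, hgx, ← hE, E.symm_apply_apply, Complex.one_im,
      sub_zero, sub_zero] at hs
    exact (div_pos_iff_of_pos_right hs0).1 hs
  refine ⟨T, fun p => ?_⟩
  have hp := congrArg Subtype.val (isometry_sphere_eq_self E hE hg_iso hg_surj hgx hg p)
  exact (T.symm_apply_eq.1 hp).symm
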